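/- Let p be an odd prime and suppose x, y, z are nonzero pairwise coprime integers with x^p + y^p = z^p and p ∣ z, and set α = (x+y)/(1−ζ) − y ∈ ℤ[ζ]. Then for all a, b ∈ {1, …, p−1} with a ≠ b, the ideal of ℤ[ζ] generated by σ_a(α) and σ_b(α) is the unit ideal (1). -/

import Mathlib

/-- If `ω ≠ 1` is a `p`-th root of unity lying in a subalgebra, then `1 - ω` divides `p` there. -/
theorem exists_natCast_eq_one_sub_mul {K : Type*} [Field K] (S : Subalgebra ℤ K) {p : ℕ} {ω : K}
    (hS : ω ∈ S) (hpow : ω ^ p = 1) (hne : ω ≠ 1) : ∃ q ∈ S, (p : K) = (1 - ω) * q := by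
  refine ⟨∑ i ∈ Finset.range p, ∑ j ∈ Finset.range i, ω ^ j,
    S.sum_mem fun i _ => S.sum_mem fun j _ => S.pow_mem hS j, ?_⟩
  have hsum : ∑ i ∈ Finset.range p, ω ^ i = 0 := by
    rw [geom_sum_eq hne, hpow, sub_self, zero_div]
  rw [Finset.mul_sum]
  simp only [mul_neg_geom_sum, Finset.sum_sub_distrib, hsum]
  simp

/-- If `p` is an odd prime dividing `z`, where `x ^ p + y ^ p = z ^ p` and `x`, `z` are coprime,
then `p ^ 2` divides `x + y`. -/
theorem sq_dvd_add_of_pow_add_pow_eq_pow {p : ℕ} (hp : p.Prime) (hodd : Odd p) {x y z : ℤ}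
    (hxz : IsCoprime x z) (h : x ^ p + y ^ p = z ^ p) (hpz : (p : ℤ) ∣ z) :
    (p : ℤ) ^ 2 ∣ x + y := by
  have : Fact p.Prime := ⟨hp⟩
  have hp3 : 3 ≤ p := by
    obtain ⟨k, rfl⟩ := hodd
    have := hp.two_le
    omega
  have hpx : ¬ (p : ℤ) ∣ x := fun hx =>
    (Nat.prime_iff_prime_int.mp hp).not_isUnit (hxz.isUnit_of_dvd' hx hpz)
  have hps : (p : ℤ) ∣ x + y := by
    rw [← ZMod.intCast_zmod_eq_zero_iff_dvd] at hpz ⊢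
    have := congrArg (Int.cast : ℤ → ZMod p) h
    push_cast [ZMod.pow_card, hpz] at this ⊢
    exact this
  have hlte := Int.emultiplicity_pow_add_pow hp hodd hps hpx hodd
  have hcube : (p : ℤ) ^ 3 ∣ x ^ p + y ^ p :=
    h ▸ (pow_dvd_pow _ hp3).trans (pow_dvd_pow_of_dvd hpz p)
  rw [pow_dvd_iff_le_emultiplicity, hlte, hp.emultiplicity_self] at hcube
  rw [pow_dvd_iff_le_emultiplicity]
  exact (ENat.add_le_add_iff_right ENat.one_ne_top).mp (by norm_num at hcube ⊢; exact hcube)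

/-- Let `p` be an odd prime, `(x, y, z)` a nonzero pairwise coprime solution of the Fermat
equation with `p ∣ z`, `ζ` a primitive `p`-th root of unity and
`σ_c(α) = (x+y)/(1−ζ^c) − y` the conjugates of the characteristic number.  Then for
`a ≠ b` in `{1, …, p−1}` the ideal of `ℤ[ζ]` generated by `σ_a(α)` and `σ_b(α)` is the
unit ideal, i.e. `1` is a `ℤ[ζ]`-linear combination of them. -/
theorem conjugates_coprime {p : ℕ} (hp : p.Prime) (hodd : Odd p)
    (x y z : ℤ) (hx : x ≠ 0) (hy : y ≠ 0) (hz : z ≠ 0)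
    (hxy : IsCoprime x y) (hyz : IsCoprime y z) (hxz : IsCoprime x z)
    (h : x ^ p + y ^ p = z ^ p) (hpz : (p : ℤ) ∣ z)
    (ζ : ℂ) (hζ : IsPrimitiveRoot ζ p)
    (a b : ℕ) (ha : a ∈ Finset.Icc 1 (p - 1)) (hb : b ∈ Finset.Icc 1 (p - 1)) (hab : a ≠ b) :
    ∃ u v : ℂ, u ∈ Algebra.adjoin ℤ {ζ} ∧ v ∈ Algebra.adjoin ℤ {ζ} ∧
      u * (((x : ℂ) + y) / (1 - ζ ^ a) - y) + v * (((x : ℂ) + y) / (1 - ζ ^ b) - y) = 1 := by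
  obtain ⟨ha1, ha2⟩ := Finset.mem_Icc.mp ha
  obtain ⟨hb1, hb2⟩ := Finset.mem_Icc.mp hb
  have hap : a < p := by omega
  have hbp : b < p := by omega
  have hpow (n : ℕ) : (ζ ^ n) ^ p = 1 := by rw [pow_right_comm, hζ.pow_eq_one, one_pow]
  have hζa : ζ ^ a ≠ 1 := hζ.pow_ne_one_of_pos_of_lt (by omega) hap
  have hζb : ζ ^ b ≠ 1 := hζ.pow_ne_one_of_pos_of_lt (by omega) hbp
  have hinv : ζ ^ a * ζ ^ (p - a) = 1 := by rw [← pow_add, Nat.add_sub_of_le hap.le, hζ.pow_eq_one]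
  have hquot : ζ ^ (b + (p - a)) ≠ 1 := by
    intro h1
    refine hab (hζ.pow_inj hap hbp ?_)
    rw [pow_add] at h1
    exact (mul_right_cancel₀ (right_ne_zero_of_mul_eq_one hinv) (h1.trans hinv.symm)).symm
  set S := Algebra.adjoin ℤ {ζ}
  have hS (n : ℕ) : ζ ^ n ∈ S := S.pow_mem (Algebra.self_mem_adjoin_singleton ℤ ζ) n
  have hint (n : ℤ) : (n : ℂ) ∈ S := S.algebraMap_mem n
  obtain ⟨q, hqS, hq⟩ := exists_natCast_eq_one_sub_mul S (hS a) (hpow a) hζa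
  obtain ⟨e, heS, he⟩ := exists_natCast_eq_one_sub_mul S (hS _) (hpow _) hquot
  obtain ⟨k, hk⟩ := sq_dvd_add_of_pow_add_pow_eq_pow hp hodd hxz h hpz
  obtain ⟨m, n, hmn⟩ := hxy
  obtain ⟨r, t, hrt⟩ := hyz.of_isCoprime_of_dvd_right hpz
  have hk' : (x : ℂ) + y = (p : ℂ) ^ 2 * k := mod_cast congrArg (Int.cast : ℤ → ℂ) hk
  have hmn' : (m : ℂ) * x + n * y = 1 := mod_cast congrArg (Int.cast : ℤ → ℂ) hmn
  have hrt' : (r : ℂ) * y + t * p = 1 := mod_cast congrArg (Int.cast : ℤ → ℂ) hrt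
  have hA : 1 - ζ ^ a ≠ 0 := sub_ne_zero.mpr hζa.symm
  have hB : 1 - ζ ^ b ≠ 0 := sub_ne_zero.mpr hζb.symm
  set α := ((x : ℂ) + y) / (1 - ζ ^ a) - y with hα
  set β := ((x : ℂ) + y) / (1 - ζ ^ b) - y with hβ
  have hαA : (1 - ζ ^ a) * α = x + y * ζ ^ a := by rw [hα]; field_simp; ring
  have hβB : (1 - ζ ^ b) * β = x + y * ζ ^ b := by rw [hβ]; field_simp; ring
  have hdiff : ζ ^ a - ζ ^ b = (n - m * ζ ^ b) * ((1 - ζ ^ a) * α)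
      + (m * ζ ^ a - n) * ((1 - ζ ^ b) * β) := by
    rw [hαA, hβB]
    linear_combination -(ζ ^ a - ζ ^ b) * hmn'
  have hpe : (p : ℂ) = (ζ ^ a - ζ ^ b) * (ζ ^ (p - a) * e) := by
    rw [pow_add] at he
    linear_combination he - e * hinv
  have hαy : α = p * (k * q) - y := by
    rw [hα, hk', sub_left_inj, div_eq_iff hA]
    linear_combination (p : ℂ) * k * hq
  set c := ζ ^ (p - a) * e * (r * (k * q) + t) with hc
  have hcS : c ∈ S := S.mul_mem (S.mul_mem (hS _) heS)
    (S.add_mem (S.mul_mem (hint r) (S.mul_mem (hint k) hqS)) (hint t))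
  refine ⟨c * ((n - m * ζ ^ b) * (1 - ζ ^ a)) - r, c * ((m * ζ ^ a - n) * (1 - ζ ^ b)),
    S.sub_mem (S.mul_mem hcS (S.mul_mem (S.sub_mem (hint n) (S.mul_mem (hint m) (hS b)))
      (S.sub_mem S.one_mem (hS a)))) (hint r),
    S.mul_mem hcS (S.mul_mem (S.sub_mem (S.mul_mem (hint m) (hS a)) (hint n))
      (S.sub_mem S.one_mem (hS b))), ?_⟩
  calc _ = c * (ζ ^ a - ζ ^ b) - r * α := by rw [hdiff]; ring
    _ = p * (r * (k * q) + t) - r * α := by rw [hc]; linear_combination -(r * (k * q) + t) * hpe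
    _ = 1 := by rw [hαy]; linear_combination hrt'
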